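/- Let Z = X union Y where X and Y are finite sets of distinct points in R^n, and set W = X \ (X intersect Y) = X \ Y. Then the weight vector w_Z of Z, restricted to the indices corresponding to W, satisfies w_Z|_W = (Z_Z / Z_Y)^{-1} ( 1_W - Z_Z[W][Y] w_Y ), where Z_Z / Z_Y = Z_Z[W][W] - Z_Z[W][Y] (Z_Z[Y][Y])^{-1} (Z_Z[W][Y])^T is the Schur complement of the principal submatrix of Z_Z indexed by Y, Z_Z[W][Y] is the block of Z_Z with rows indexed by W and columns indexed by Y, 1_W is the all-ones vector indexed by W, and w_Y is the weight vector of Y. -/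

import Mathlib

open Matrix

/-- The similarity matrix of a family of points in Euclidean space:
entries `exp (-‖p - q‖)`. -/
noncomputable def simMatrix {m : Type*} {n : ℕ} (x : m → EuclideanSpace ℝ (Fin n)) :
    Matrix m m ℝ :=
  Matrix.of fun i j => Real.exp (-dist (x i) (x j))

/-- The quadratic form of a matrix. -/
def qform {ι : Type*} [Fintype ι] (A : ι → ι → ℝ) (c : ι → ℝ) : ℝ :=
  ∑ i, ∑ j, c i * c j * A i j

lemma qform_eq {ι : Type*} [Fintype ι] (A : Matrix ι ι ℝ) (c : ι → ℝ) :
    star c ⬝ᵥ (A *ᵥ c) = qform A c := by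
  simp only [qform, dotProduct, mulVec, Finset.mul_sum, star_trivial]
  refine Finset.sum_congr rfl fun i _ => Finset.sum_congr rfl fun j _ => ?_
  ring

lemma posSemidef_pow {ι : Type*} [Fintype ι] (K : Matrix ι ι ℝ) (hK : K.PosSemidef) (k : ℕ) :
    (Matrix.of fun i j => K i j ^ k).PosSemidef := by
  induction k with
  | zero =>
    rw [posSemidef_iff_dotProduct_mulVec]
    refine ⟨by ext i j; simp, fun c => ?_⟩
    rw [qform_eq]
    have : qform (Matrix.of fun i j => K i j ^ 0) c = (∑ i, c i) ^ 2 := by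
      simp only [qform, Matrix.of_apply, pow_zero, mul_one, sq, Finset.sum_mul_sum]
    rw [this]; positivity
  | succ k ih =>
    have := ih.hadamard hK
    have e : (Matrix.of fun i j => K i j ^ (k + 1)) = (Matrix.of fun i j => K i j ^ k) ⊙ K := by
      ext i j
      simp [pow_succ]
    rw [e]
    exact this

lemma qform_exp_ge {ι : Type*} [Fintype ι] (K : Matrix ι ι ℝ) (hK : K.PosSemidef) (c : ι → ℝ) :
    (∑ i, c i) ^ 2 + qform K c ≤ qform (fun i j => Real.exp (K i j)) c := by
  have hs : HasSum (fun k : ℕ => ∑ i, ∑ j, c i * c j * (K i j ^ k / k.factorial))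
      (qform (fun i j => Real.exp (K i j)) c) := by
    refine hasSum_sum fun i _ => hasSum_sum fun j _ => HasSum.mul_left _ ?_
    rw [Real.exp_eq_exp_ℝ]
    exact NormedSpace.expSeries_div_hasSum_exp (K i j)
  have h := sum_le_hasSum (Finset.range 2) (fun k _ => ?_) hs
  · refine le_trans (le_of_eq ?_) h
    simp [Finset.sum_range_succ, qform, sq, Finset.sum_mul_sum]
  · have h1 := (posSemidef_pow K hK k).dotProduct_mulVec_nonneg c
    rw [qform_eq] at h1
    have : ∑ i, ∑ j, c i * c j * (K i j ^ k / k.factorial)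
        = qform (Matrix.of fun i j => K i j ^ k) c / k.factorial := by
      simp only [qform, Finset.sum_div, Matrix.of_apply, mul_div_assoc]
    rw [this]; positivity

lemma qform_gauss_nonneg {ι : Type*} [Fintype ι] {n : ℕ} (x : ι → EuclideanSpace ℝ (Fin n))
    (t : ℝ) (c : ι → ℝ) :
    0 ≤ qform (fun i j => Real.exp (-(dist (x i) (x j) * t) ^ 2)) c := by
  have hK : ((2 * t ^ 2) • Matrix.gram ℝ x).PosSemidef :=
    (posSemidef_gram ℝ x).smul (by positivity)
  have h := qform_exp_ge _ hK (fun i => c i * Real.exp (-(t * ‖x i‖) ^ 2))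
  have h2 := hK.dotProduct_mulVec_nonneg (fun i => c i * Real.exp (-(t * ‖x i‖) ^ 2))
  rw [qform_eq] at h2
  refine le_trans (by positivity) (h.trans (le_of_eq ?_))
  unfold qform
  refine Finset.sum_congr rfl fun i _ => Finset.sum_congr rfl fun j _ => ?_
  have : -(dist (x i) (x j) * t) ^ 2 = -(t * ‖x i‖) ^ 2 + -(t * ‖x j‖) ^ 2
      + ((2 * t ^ 2) • Matrix.gram ℝ x) i j := by
    rw [dist_eq_norm, mul_pow, norm_sub_sq_real]
    simp only [Matrix.smul_apply, Matrix.gram_apply, smul_eq_mul]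
    ring
  beta_reduce
  rw [this, Real.exp_add, Real.exp_add]
  ring

lemma integrable_g : MeasureTheory.Integrable (fun t : ℝ => (1 - Real.exp (-t ^ 2)) / t ^ 2) := by
  refine (integrable_inv_one_add_sq.const_mul 2).mono' ?_ (Filter.Eventually.of_forall fun t => ?_)
  · exact Measurable.aestronglyMeasurable (by fun_prop)
  · have h0 : 0 ≤ 1 - Real.exp (-t ^ 2) := by
      have : Real.exp (-t ^ 2) ≤ 1 := Real.exp_le_one_iff.2 (by nlinarith [sq_nonneg t])
      linarith
    rw [Real.norm_of_nonneg (by positivity)]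
    rcases eq_or_ne t 0 with rfl | ht
    · simp
    have hu : 0 < t ^ 2 := by positivity
    rw [← div_eq_mul_inv, div_le_div_iff₀ hu (by positivity)]
    have h1 := Real.add_one_le_exp (-t ^ 2)
    have h2 := Real.exp_pos (-t ^ 2)
    nlinarith

lemma integral_g (r : ℝ) (hr : 0 ≤ r) :
    ∫ t : ℝ, (1 - Real.exp (-(r * t) ^ 2)) / t ^ 2 =
      r * ∫ t : ℝ, (1 - Real.exp (-t ^ 2)) / t ^ 2 := by
  rcases hr.eq_or_lt with rfl | hr
  · simp
  have h := MeasureTheory.Measure.integral_comp_mul_left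
    (fun t : ℝ => (1 - Real.exp (-t ^ 2)) / t ^ 2) r
  have h2 : ∀ t : ℝ, (1 - Real.exp (-(r * t) ^ 2)) / t ^ 2 =
      r ^ 2 * ((1 - Real.exp (-(r * t) ^ 2)) / (r * t) ^ 2) := by
    intro t
    rcases eq_or_ne t 0 with rfl | ht
    · simp
    field_simp
  simp_rw [h2]
  rw [MeasureTheory.integral_const_mul, h, abs_of_pos (by positivity), smul_eq_mul]
  field_simp

lemma integrable_g' (r : ℝ) :
    MeasureTheory.Integrable (fun t : ℝ => (1 - Real.exp (-(r * t) ^ 2)) / t ^ 2) := by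
  rcases eq_or_ne r 0 with rfl | hr
  · simp
  have h := (integrable_g.comp_mul_left' hr).const_mul (r ^ 2)
  refine h.congr (Filter.Eventually.of_forall fun t => ?_)
  rcases eq_or_ne t 0 with rfl | ht
  · simp
  simp only
  field_simp

lemma qform_dist_neg {ι : Type*} [Fintype ι] {n : ℕ} (x : ι → EuclideanSpace ℝ (Fin n))
    (hx : Function.Injective x) (c : ι → ℝ) (hc : c ≠ 0) (hs : ∑ i, c i = 0) :
    qform (fun i j => dist (x i) (x j)) c < 0 := by
  classical
  set Q : ℝ → ℝ := fun t => qform (fun i j => Real.exp (-(dist (x i) (x j) * t) ^ 2)) c with hQ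
  have hQ0 : ∀ t, 0 ≤ Q t := fun t => qform_gauss_nonneg x t c
  have hzero : ∑ i, ∑ j, c i * c j = 0 := by
    rw [← Finset.sum_mul_sum, hs]; simp
  have key : ∀ t, Q t / t ^ 2 =
      -∑ i, ∑ j, c i * c j * ((1 - Real.exp (-(dist (x i) (x j) * t) ^ 2)) / t ^ 2) := by
    intro t
    have : ∑ i, ∑ j, c i * c j * ((1 - Real.exp (-(dist (x i) (x j) * t) ^ 2)) / t ^ 2)
        = (∑ i, ∑ j, c i * c j - Q t) / t ^ 2 := by
      simp only [hQ, qform, ← Finset.sum_sub_distrib, Finset.sum_div]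
      refine Finset.sum_congr rfl fun i _ => Finset.sum_congr rfl fun j _ => ?_
      ring
    rw [this, hzero]; ring
  have hint : MeasureTheory.Integrable (fun t => Q t / t ^ 2) := by
    simp_rw [key]
    refine (MeasureTheory.integrable_finsetSum _ fun i _ =>
      MeasureTheory.integrable_finsetSum _ fun j _ => (integrable_g' _).const_mul _).neg
  have hval : ∫ t, Q t / t ^ 2 = -(qform (fun i j => dist (x i) (x j)) c *
      ∫ t : ℝ, (1 - Real.exp (-t ^ 2)) / t ^ 2) := by
    simp_rw [key]
    rw [MeasureTheory.integral_neg, MeasureTheory.integral_finsetSum _ fun i _ =>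
      MeasureTheory.integrable_finsetSum _ fun j _ => (integrable_g' _).const_mul _]
    congr 1
    rw [qform, Finset.sum_mul]
    refine Finset.sum_congr rfl fun i _ => ?_
    rw [MeasureTheory.integral_finsetSum _ fun j _ => (integrable_g' _).const_mul _,
      Finset.sum_mul]
    refine Finset.sum_congr rfl fun j _ => ?_
    rw [MeasureTheory.integral_const_mul, integral_g _ dist_nonneg]
    ring
  have hlim : Filter.Tendsto Q Filter.atTop (nhds (∑ i, c i ^ 2)) := by
    have : ∑ i, c i ^ 2 = ∑ i, ∑ j, c i * c j * (if i = j then 1 else 0) := by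
      simp [sq]
    rw [this]
    refine tendsto_finsetSum _ fun i _ => tendsto_finsetSum _ fun j _ =>
      Filter.Tendsto.const_mul _ ?_
    split_ifs with h
    · subst h; simp
    · have hd : 0 < dist (x i) (x j) := dist_pos.2 (hx.ne h)
      refine Real.tendsto_exp_neg_atTop_nhds_zero.comp ?_
      exact (Filter.tendsto_pow_atTop two_ne_zero).comp
        (Filter.Tendsto.const_mul_atTop hd Filter.tendsto_id)
  have hpos : 0 < ∑ i, c i ^ 2 := by
    obtain ⟨i, hi⟩ := Function.ne_iff.1 hc
    have hi : c i ≠ 0 := hi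
    exact Finset.sum_pos' (fun i _ => sq_nonneg _) ⟨i, Finset.mem_univ _, by positivity⟩
  have hip : 0 < ∫ t, Q t / t ^ 2 := by
    rw [MeasureTheory.integral_pos_iff_support_of_nonneg
      (fun t => div_nonneg (hQ0 t) (sq_nonneg t)) hint]
    obtain ⟨T, hT⟩ := Filter.eventually_atTop.1
      ((hlim.eventually (lt_mem_nhds hpos)).and (Filter.eventually_gt_atTop 0))
    refine lt_of_lt_of_le (?_ : 0 < MeasureTheory.volume (Set.Ici T))
      (MeasureTheory.measure_mono ?_)
    · simp
    · intro t ht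
      obtain ⟨h1, h2⟩ := hT t ht
      exact (div_pos h1 (by positivity)).ne'
  have hI : 0 ≤ ∫ t : ℝ, (1 - Real.exp (-t ^ 2)) / t ^ 2 := by
    refine MeasureTheory.integral_nonneg fun t => div_nonneg ?_ (sq_nonneg t)
    have : Real.exp (-t ^ 2) ≤ 1 := Real.exp_le_one_iff.2 (by nlinarith [sq_nonneg t])
    linarith
  rw [hval] at hip
  by_contra! hcon
  nlinarith [mul_nonneg hcon hI]

lemma simMatrix_posDef {ι : Type*} [Fintype ι] {n : ℕ} (x : ι → EuclideanSpace ℝ (Fin n))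
    (hx : Function.Injective x) : (simMatrix x).PosDef := by
  classical
  rw [posDef_iff_dotProduct_mulVec]
  refine ⟨by ext i j; simp [simMatrix, dist_comm], fun {c} hc => ?_⟩
  rw [qform_eq]
  obtain ⟨o, -⟩ := Function.ne_iff.1 hc
  set K : Matrix ι ι ℝ := Matrix.of fun i j =>
    dist (x i) (x o) + dist (x j) (x o) - dist (x i) (x j) with hKdef
  set p : (ι → ℝ) → ι → ℝ := fun b i => b i - (∑ k, b k) * (if i = o then 1 else 0) with hp
  have hps : ∀ b, ∑ i, p b i = 0 := by intro b; simp [hp]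
  have hKq : ∀ b, qform K b = - qform (fun i j => dist (x i) (x j)) (p b) := by
    intro b
    have e1 : qform K b = (∑ i, b i * dist (x i) (x o)) * (∑ j, b j)
        + (∑ i, b i) * (∑ j, b j * dist (x j) (x o))
        - qform (fun i j => dist (x i) (x j)) b := by
      simp only [qform, Finset.sum_mul_sum, ← Finset.sum_add_distrib, ← Finset.sum_sub_distrib]
      refine Finset.sum_congr rfl fun i _ => Finset.sum_congr rfl fun j _ => ?_
      simp only [hKdef, Matrix.of_apply]; ring
    have e2 : qform (fun i j => dist (x i) (x j)) (p b) =
        qform (fun i j => dist (x i) (x j)) b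
        - ∑ i, ∑ j, b i * (∑ k, b k) * (dist (x i) (x j) * (if j = o then 1 else 0))
        - ∑ i, ∑ j, (∑ k, b k) * b j * (dist (x i) (x j) * (if i = o then 1 else 0))
        + ∑ i, ∑ j, (∑ k, b k) ^ 2 *
          (dist (x i) (x j) * (if i = o then 1 else 0) * (if j = o then 1 else 0)) := by
      simp only [qform, ← Finset.sum_add_distrib, ← Finset.sum_sub_distrib]
      refine Finset.sum_congr rfl fun i _ => Finset.sum_congr rfl fun j _ => ?_
      simp only [hp]; ring
    have e3 : ∑ i, ∑ j, b i * (∑ k, b k) * (dist (x i) (x j) * (if j = o then 1 else 0))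
        = (∑ i, b i * dist (x i) (x o)) * (∑ j, b j) := by
      rw [Finset.sum_mul]
      refine Finset.sum_congr rfl fun i _ => ?_
      simp only [mul_ite, mul_one, mul_zero, Finset.sum_ite_eq', Finset.mem_univ, if_true]
      ring
    have e4 : ∑ i, ∑ j, (∑ k, b k) * b j * (dist (x i) (x j) * (if i = o then 1 else 0))
        = (∑ i, b i) * (∑ j, b j * dist (x j) (x o)) := by
      rw [Finset.sum_comm, Finset.mul_sum]
      refine Finset.sum_congr rfl fun i _ => ?_
      simp only [mul_ite, mul_one, mul_zero, Finset.sum_ite_eq', Finset.mem_univ, if_true]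
      rw [dist_comm]; ring
    have e5 : ∑ i, ∑ j, (∑ k, b k) ^ 2 *
          (dist (x i) (x j) * (if i = o then 1 else 0) * (if j = o then 1 else 0)) = 0 := by
      simp
    rw [e1, e2, e3, e4, e5]; ring
  have hKpos : ∀ b, p b ≠ 0 → 0 < qform K b := fun b hb => by
    rw [hKq]; have := qform_dist_neg x hx (p b) hb (hps b); linarith
  have hKz : ∀ b, p b = 0 → qform K b = 0 := fun b hb => by
    rw [hKq, hb]; simp [qform]
  have hK : K.PosSemidef := by
    rw [posSemidef_iff_dotProduct_mulVec]
    refine ⟨by ext i j; simp [hKdef, dist_comm, add_comm], fun b => ?_⟩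
    rw [qform_eq]
    by_cases hb : p b = 0
    · exact (hKz b hb).ge
    · exact (hKpos b hb).le
  set b : ι → ℝ := fun i => c i * Real.exp (-dist (x i) (x o)) with hbdef
  have hb0 : b ≠ 0 := by
    intro h
    apply hc
    funext i
    have := congrFun h i
    simpa [hbdef, Real.exp_ne_zero] using this
  have hq : qform (simMatrix x) c = qform (fun i j => Real.exp (K i j)) b := by
    unfold qform
    refine Finset.sum_congr rfl fun i _ => Finset.sum_congr rfl fun j _ => ?_
    have : -dist (x i) (x j) = -dist (x i) (x o) + -dist (x j) (x o) + K i j := by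
      simp only [hKdef, Matrix.of_apply]; ring
    simp only [simMatrix, Matrix.of_apply]
    rw [this, Real.exp_add, Real.exp_add]
    simp only [hbdef]; ring
  rw [hq]
  refine lt_of_lt_of_le ?_ (qform_exp_ge K hK b)
  by_cases hb : p b = 0
  · rw [hKz b hb, add_zero]
    have : ∑ i, b i ≠ 0 := by
      intro h
      apply hb0
      funext i
      have := congrFun hb i
      simpa [hp, h] using this
    positivity
  · have := hKpos b hb
    positivity

/-- Let `Z = X ∪ Y` be a finite set of distinct points of `ℝⁿ` (indexed by `Fin N`, with
`X`, `Y` indexed by `PX`, `PY`, `PX ∪ PY = univ`), and let `W = X \ (X ∩ Y) = X \ Y` be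
indexed by `PX \ PY`.  Then the weight vector `w_Z` of `Z` restricted to `W` satisfies
`w_Z|_W = (ζ_Z/ζ_Y)⁻¹ (𝟙_W - ζ_Z[W][Y] w_Y)`, where
`ζ_Z/ζ_Y = ζ_Z[W][W] - ζ_Z[W][Y] (ζ_Z[Y][Y])⁻¹ (ζ_Z[W][Y])ᵀ` and `w_Y` is the weight
vector of `Y`. -/
theorem weight_of_union_restricted {N n : ℕ} (z : Fin N → EuclideanSpace ℝ (Fin n))
    (hz : Function.Injective z) (PX PY : Finset (Fin N))
    (hcover : PX ∪ PY = Finset.univ) :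
    (fun i : ↥(PX \ PY) => ((simMatrix z)⁻¹ *ᵥ 1) i) =
      ((simMatrix z).submatrix ((↑) : ↥(PX \ PY) → Fin N) ((↑) : ↥(PX \ PY) → Fin N) -
          (simMatrix z).submatrix ((↑) : ↥(PX \ PY) → Fin N) ((↑) : ↥PY → Fin N) *
            ((simMatrix z).submatrix ((↑) : ↥PY → Fin N) ((↑) : ↥PY → Fin N))⁻¹ *
            ((simMatrix z).submatrix ((↑) : ↥(PX \ PY) → Fin N) ((↑) : ↥PY → Fin N))ᵀ)⁻¹ *ᵥ
        (1 - (simMatrix z).submatrix ((↑) : ↥(PX \ PY) → Fin N) ((↑) : ↥PY → Fin N) *ᵥ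
          ((simMatrix (fun i : ↥PY => z i))⁻¹ *ᵥ 1)) := by
  set M := simMatrix z with hM
  have hMpd : M.PosDef := simMatrix_posDef z hz
  have hYeq : simMatrix (fun i : ↥PY => z i) =
      M.submatrix ((↑) : ↥PY → Fin N) ((↑) : ↥PY → Fin N) := rfl
  rw [hYeq]
  set A := M.submatrix ((↑) : ↥PY → Fin N) ((↑) : ↥PY → Fin N) with hA
  set C := M.submatrix ((↑) : ↥(PX \ PY) → Fin N) ((↑) : ↥PY → Fin N) with hC
  set D := M.submatrix ((↑) : ↥(PX \ PY) → Fin N) ((↑) : ↥(PX \ PY) → Fin N) with hD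
  have hApd : A.PosDef := hMpd.submatrix Subtype.val_injective
  have hAu : IsUnit A := hApd.isUnit
  have hAdet : IsUnit A.det := (Matrix.isUnit_iff_isUnit_det A).1 hAu
  have hMdet : IsUnit M.det := (Matrix.isUnit_iff_isUnit_det M).1 hMpd.isUnit
  have hsymm : ∀ i j, M i j = M j i := fun i j => by simp [hM, simMatrix, dist_comm]
  let f : ↥PY ⊕ ↥(PX \ PY) → Fin N := Sum.elim (↑) (↑)
  have hf : Function.Bijective f := by
    constructor
    · rintro (⟨a, ha⟩ | ⟨a, ha⟩) (⟨b, hb⟩ | ⟨b, hb⟩) h <;>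
        simp only [f, Sum.elim_inl, Sum.elim_inr] at h <;> subst h
      · rfl
      · exact absurd ha (Finset.mem_sdiff.1 hb).2
      · exact absurd hb (Finset.mem_sdiff.1 ha).2
      · rfl
    · intro i
      by_cases hi : i ∈ PY
      · exact ⟨Sum.inl ⟨i, hi⟩, rfl⟩
      · have : i ∈ PX ∪ PY := hcover ▸ Finset.mem_univ i
        have hX : i ∈ PX \ PY := by
          rw [Finset.mem_sdiff]; exact ⟨(Finset.mem_union.1 this).resolve_right hi, hi⟩
        exact ⟨Sum.inr ⟨i, hX⟩, rfl⟩
  have hblock : M.submatrix f f = Matrix.fromBlocks A Cᵀ C D := by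
    ext (i | i) (j | j)
    · rfl
    · exact hsymm _ _
    · rfl
    · rfl
  have hSu : IsUnit (D - C * A⁻¹ * Cᵀ) := by
    letI := hAu.invertible
    have h : IsUnit (M.submatrix f f) := (hMpd.submatrix hf.1).isUnit
    rw [hblock, Matrix.isUnit_fromBlocks_iff_of_invertible₁₁, Matrix.invOf_eq_nonsing_inv] at h
    exact h
  have hSdet := (Matrix.isUnit_iff_isUnit_det _).1 hSu
  set w : Fin N → ℝ := M⁻¹ *ᵥ 1 with hw
  have hMw : M *ᵥ w = 1 := by
    rw [hw, Matrix.mulVec_mulVec, Matrix.mul_nonsing_inv _ hMdet, Matrix.one_mulVec]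
  have hsplit : ∀ i, ∑ j : ↥PY, M i j * w j + ∑ j : ↥(PX \ PY), M i j * w j = 1 := by
    intro i
    have h1 : ∑ j, M i j * w j = 1 := congrFun hMw i
    rw [← h1, ← (Equiv.ofBijective f hf).sum_comp, Fintype.sum_sum_type]
    rfl
  set a : ↥PY → ℝ := fun i => w i with ha
  set b : ↥(PX \ PY) → ℝ := fun i => w i with hb
  have h1 : A *ᵥ a + Cᵀ *ᵥ b = 1 := by
    funext i
    refine Eq.trans ?_ (hsplit i)
    simp only [Pi.add_apply, mulVec, dotProduct, Matrix.transpose_apply, hA, hC,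
      Matrix.submatrix_apply, ha, hb]
    congr 1
    exact Finset.sum_congr rfl fun j _ => by rw [hsymm]
  have h2 : C *ᵥ a + D *ᵥ b = 1 := by
    funext i
    exact hsplit i
  have h3 : a = A⁻¹ *ᵥ 1 - A⁻¹ *ᵥ (Cᵀ *ᵥ b) := by
    rw [← Matrix.mulVec_sub, ← h1, add_sub_cancel_right, Matrix.mulVec_mulVec,
      Matrix.nonsing_inv_mul _ hAdet, Matrix.one_mulVec]
  have h4 : (D - C * A⁻¹ * Cᵀ) *ᵥ b = 1 - C *ᵥ (A⁻¹ *ᵥ 1) := by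
    rw [← h2, Matrix.sub_mulVec]
    conv_rhs => rw [h3]
    rw [Matrix.mulVec_sub]
    simp only [← Matrix.mulVec_mulVec]
    abel
  rw [← h4, Matrix.mulVec_mulVec, Matrix.nonsing_inv_mul _ hSdet, Matrix.one_mulVec]
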